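/- Let Σ₀ ⊆ Σ \ {<s>, <EOS>, ACC, REJ} contain at least the symbols 0, 1, and #. There exist no integer N ≥ 3 and next-token function f : Σ^{≤N} → Σ such that the summarization-style system determined by (N, f) decides the equality language {w # w : w ∈ {0,1}*} over Σ₀. -/

import Mathlib

/-!
The summarization-style context-management system.

The alphabet is a finite type `A` containing distinguished tokens
`sTok` (`<s>`, summary instruction), `eosTok` (`<EOS>`), `accTok` (`ACC`),
`rejTok` (`REJ`).  `N` is the context-window length, and `f : List A → A`
abstracts one decoding step of a fixed finite-precision Transformer with a
deterministic decoding rule (the system only ever evaluates `f` on strings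
of length at most `N`).
-/

variable {A : Type} [DecidableEq A]

/-- The token decoded from the maintained string `r`:
in the normal phase (`|r| < N - 1`) it is `f r`; in the summarization phase
(`|r| ≥ N - 1`) it is `f (<s> · r₁ ⋯ r_{N-1})`. -/
def sumDec (N : ℕ) (sTok : A) (f : List A → A) (r : List A) : A :=
  if r.length < N - 1 then f r else f (sTok :: r.take (N - 1))

/-- One step of the summarization-style system: `none` means the system halts
(the decoded token in the normal phase was `<EOS>`). -/
def sumStep (N : ℕ) (sTok eosTok : A) (f : List A → A) (r : List A) :
    Option (List A) :=
  if r.length < N - 1 then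
    if f r = eosTok then none else some (r ++ [f r])
  else
    some (f (sTok :: r.take (N - 1)) :: r.drop (N - 1))

/-- `sumTraj N sTok eosTok f x t` is the maintained string `r⁽ᵗ⁺¹⁾` (so index `0`
corresponds to `r⁽¹⁾ = x`), or `none` if the system has halted by then. -/
def sumTraj (N : ℕ) (sTok eosTok : A) (f : List A → A) (x : List A) :
    ℕ → Option (List A)
  | 0 => some x
  | t + 1 => (sumTraj N sTok eosTok f x t).bind (sumStep N sTok eosTok f)

/-- The system halts on input `x`. -/
def sumHalts (N : ℕ) (sTok eosTok : A) (f : List A → A) (x : List A) : Prop :=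
  ∃ t, sumTraj N sTok eosTok f x t = none

/-- The system accepts `x`: at some step the decoded token is `ACC`. -/
def sumAccepts (N : ℕ) (sTok eosTok accTok : A) (f : List A → A)
    (x : List A) : Prop :=
  ∃ t r, sumTraj N sTok eosTok f x t = some r ∧ sumDec N sTok f r = accTok

/-- The system rejects `x`: at some step the decoded token is `REJ`. -/
def sumRejects (N : ℕ) (sTok eosTok rejTok : A) (f : List A → A)
    (x : List A) : Prop :=
  ∃ t r, sumTraj N sTok eosTok f x t = some r ∧ sumDec N sTok f r = rejTok

/-- The system decides the language `L ⊆ Σ₀*`: on every input `x ∈ Σ₀*` it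
halts, it accepts `x` iff `x ∈ L`, and it rejects `x` iff `x ∉ L`. -/
def sumDecides (N : ℕ) (sTok eosTok accTok rejTok : A) (f : List A → A)
    (S₀ : Set A) (L : Set (List A)) : Prop :=
  ∀ x : List A, (∀ c ∈ x, c ∈ S₀) →
    sumHalts N sTok eosTok f x ∧
    (sumAccepts N sTok eosTok accTok f x ↔ x ∈ L) ∧
    (sumRejects N sTok eosTok rejTok f x ↔ x ∉ L)

theorem sumTraj_add {N : ℕ} {sTok eosTok : A} {f : List A → A} {x r : List A} {j : ℕ}
    (h : sumTraj N sTok eosTok f x j = some r) (t : ℕ) :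
    sumTraj N sTok eosTok f x (j + t) = sumTraj N sTok eosTok f r t := by
  induction t with
  | zero => simpa [sumTraj] using h
  | succ t ih => rw [← Nat.add_assoc, sumTraj, sumTraj, ih]

/-- While at least `N - 1` tokens of a prefix are left, the system only summarizes that prefix,
independently of what follows it. -/
theorem exists_sumTraj_append {N : ℕ} (hN : 3 ≤ N) (sTok eosTok : A) (f : List A → A)
    (p : List A) (i k : ℕ) (hp : p.length = 1 + (i + k) * (N - 2)) :
    ∃ q : List A, q.length = 1 + k * (N - 2) ∧
      ∀ y, sumTraj N sTok eosTok f (p ++ y) i = some (q ++ y) := by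
  induction i generalizing k with
  | zero => exact ⟨p, by simpa using hp, fun y => rfl⟩
  | succ i ih =>
    obtain ⟨q, hq, hqt⟩ := ih (k + 1) (by rw [hp]; ring)
    have hle : N - 1 ≤ q.length := by
      rw [hq, add_mul]
      omega
    refine ⟨f (sTok :: q.take (N - 1)) :: q.drop (N - 1), ?_, fun y => ?_⟩
    · rw [List.length_cons, List.length_drop, hq, add_mul]
      omega
    · have hlt : ¬ (q ++ y).length < N - 1 := by
        rw [List.length_append]
        omega
      rw [sumTraj, hqt y, Option.bind_some, sumStep, if_neg hlt,
        List.take_append_of_le_length hle, List.drop_append_of_le_length hle, List.cons_append]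

theorem sumDec_append {N : ℕ} (sTok : A) (f : List A → A) {q : List A}
    (hq : N - 1 ≤ q.length) (y : List A) :
    sumDec N sTok f (q ++ y) = f (sTok :: q.take (N - 1)) := by
  have hlt : ¬ (q ++ y).length < N - 1 := by
    rw [List.length_append]
    omega
  rw [sumDec, if_neg hlt, List.take_append_of_le_length hq]

/-- If the system accepts `w ++ y`, where `w` is summarized to a single token, then it either
accepts `w` already or accepts `w' ++ y` for every `w'` with the same summary. -/
theorem sumAccepts_or_of_append {N : ℕ} (hN : 3 ≤ N) {sTok eosTok accTok : A} {f : List A → A}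
    {w w' y : List A} {a : A} {j : ℕ} (hw : w.length = 1 + j * (N - 2))
    (ha : ∀ y, sumTraj N sTok eosTok f (w ++ y) j = some (a :: y))
    (ha' : ∀ y, sumTraj N sTok eosTok f (w' ++ y) j = some (a :: y))
    (h : sumAccepts N sTok eosTok accTok f (w ++ y)) :
    sumAccepts N sTok eosTok accTok f w ∨ sumAccepts N sTok eosTok accTok f (w' ++ y) := by
  obtain ⟨t, r, hr, hd⟩ := h
  rcases lt_or_ge t j with htj | htj
  · left
    obtain ⟨k, rfl⟩ := Nat.exists_eq_add_of_lt htj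
    obtain ⟨q, hq, hqt⟩ := exists_sumTraj_append hN sTok eosTok f w t (k + 1) hw
    have hle : N - 1 ≤ q.length := by
      rw [hq, add_mul]
      omega
    obtain rfl : q ++ y = r := Option.some.inj ((hqt y).symm.trans hr)
    refine ⟨t, q ++ [], by simpa using hqt [], ?_⟩
    rw [sumDec_append sTok f hle] at hd ⊢
    exact hd
  · right
    obtain ⟨s, rfl⟩ := Nat.exists_eq_add_of_le htj
    exact ⟨j + s, r, by rw [sumTraj_add (ha' y), ← sumTraj_add (ha y), hr], hd⟩

theorem List.eq_of_append_cons_eq_square {α : Type*} {u w v : List α} {c : α}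
    (hlen : u.length = w.length) (h : u ++ c :: w = v ++ c :: v) : u = w := by
  have hl := congrArg List.length h
  simp only [List.length_append, List.length_cons] at hl
  obtain ⟨h1, h2⟩ := List.append_inj h (by omega)
  rw [h1, (List.cons.inj h2).2]

/-- Let `Σ₀ ⊆ Σ \ {<s>, <EOS>, ACC, REJ}` contain at least the
(distinct) symbols `0`, `1`, `#`. No summarization-style system (for any
`N ≥ 3` and next-token function `f`) decides the equality language
`{w # w : w ∈ {0,1}*}` over `Σ₀`. -/
theorem no_summarization_system_decides_equality
    (A : Type) [Fintype A] [DecidableEq A]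
    (sTok eosTok accTok rejTok : A) (c0 c1 chash : A) (S₀ : Set A)
    (hS₀ : ∀ a ∈ S₀, a ≠ sTok ∧ a ≠ eosTok ∧ a ≠ accTok ∧ a ≠ rejTok)
    (h0 : c0 ∈ S₀) (h1 : c1 ∈ S₀) (hh : chash ∈ S₀)
    (h01 : c0 ≠ c1) (h0h : c0 ≠ chash) (h1h : c1 ≠ chash) :
    ¬ ∃ (N : ℕ) (f : List A → A), 3 ≤ N ∧
        sumDecides N sTok eosTok accTok rejTok f S₀
          {l | ∃ w : List A, (∀ c ∈ w, c = c0 ∨ c = c1) ∧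
            l = w ++ chash :: w} := by
  rintro ⟨N, f, hN, hdec⟩
  set j := Fintype.card A
  set L := 1 + j * (N - 2) with hL
  let word : (Fin L → Bool) → List A := fun b => List.ofFn fun i => if b i then c1 else c0
  have hlen : ∀ b, (word b).length = L := fun b => List.length_ofFn
  have hbin : ∀ b, ∀ c ∈ word b, c = c0 ∨ c = c1 := by
    intro b c hc
    obtain ⟨i, rfl⟩ := List.mem_ofFn.mp hc
    by_cases hb : b i <;> simp [hb]
  have hinj : Function.Injective word := by
    intro b b' h
    funext i
    have hi := congrFun (List.ofFn_injective h) i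
    cases hb : b i <;> cases hb' : b' i <;> simp_all [h01.symm]
  have hsummary : ∀ b, ∃ a, ∀ y, sumTraj N sTok eosTok f (word b ++ y) j = some (a :: y) := by
    intro b
    obtain ⟨q, hq, hqt⟩ := exists_sumTraj_append hN sTok eosTok f (word b) j 0 (hlen b)
    obtain ⟨a, rfl⟩ := List.length_eq_one_iff.mp (by simpa using hq)
    exact ⟨a, hqt⟩
  choose summary hsum using hsummary
  have hcard : Fintype.card A < Fintype.card (Fin L → Bool) := by
    have hjL : j ≤ L := by
      have := Nat.le_mul_of_pos_right j (show 0 < N - 2 by omega)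
      omega
    simpa using hjL.trans_lt Nat.lt_two_pow_self
  obtain ⟨b, b', hne, heq⟩ := Fintype.exists_ne_map_eq_of_card_lt summary hcard
  have hmem : ∀ b, ∀ c ∈ word b, c ∈ S₀ := fun b c hc => by
    rcases hbin b c hc with rfl | rfl <;> assumption
  have hmem₂ : ∀ b b', ∀ c ∈ word b ++ chash :: word b', c ∈ S₀ := by
    intro b b' c hc
    rcases List.mem_append.mp hc with hc | hc
    · exact hmem b c hc
    · rcases List.mem_cons.mp hc with rfl | hc
      · exact hh
      · exact hmem b' c hc
  have hacc := (hdec _ (hmem₂ b b)).2.1.mpr ⟨word b, hbin b, rfl⟩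
  rcases sumAccepts_or_of_append hN (hlen b) (hsum b) (heq ▸ hsum b') hacc with h | h
  · obtain ⟨v, -, hv⟩ := (hdec _ (hmem b)).2.1.mp h
    rcases hbin b chash (by simp [hv]) with h | h
    · exact h0h h.symm
    · exact h1h h.symm
  · obtain ⟨v, -, hv⟩ := (hdec _ (hmem₂ b' b)).2.1.mp h
    exact hne (hinj (List.eq_of_append_cons_eq_square
      ((hlen b').trans (hlen b).symm) hv)).symm
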